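/- Let p be odd and φ = (x−γ)² − c₁ ∈ 𝔽̄_p[t][x] non-isotrivial (deg(γ+c₁) > 0) with c₁ ≠ 0 and γ + c₁ ± √c₁ ≠ 0, with dynamical inseparability degree e. Write cₙ = dₙyₙ² with dₙ squarefree. If n ≥ 3 satisfies deg(γ+c₁)·2^{n−3} > h(φ), then deg(c_{n−1}) ≤ 8p^e·deg(dₙ) + 8p^e(deg(d₁) + 4 + 4·deg(rad c₁) + 4·deg(rad c₂)) + 4·deg(γ) + 8·deg(c₁), where d₁ is the squarefree part of c₁ and rad denotes the radical (product of distinct irreducible factors). -/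

import Mathlib

open Polynomial

/-- Elementary height bound for `d y² = (δ z² - A)² - c` via differentiation. -/
lemma core_bound {k : Type*} [Field k] (h2 : (2 : k) ≠ 0)
    (δ z A c d y : k[X]) (hδ : δ ≠ 0) (hz : z ≠ 0) (hc : c ≠ 0)
    (hB : A ^ 2 - c ≠ 0) (hd : d ≠ 0) (hy : y ≠ 0)
    (heq : (δ * z ^ 2 - A) ^ 2 - c = d * y ^ 2)
    (hA : A.natDegree < δ.natDegree + 2 * z.natDegree)
    (hcdeg : c.natDegree < 2 * (δ.natDegree + 2 * z.natDegree))
    (hns : ¬ (A * derivative c - 2 * c * derivative A = 0 ∧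
      (δ * z ^ 2 - A) * derivative c - 2 * c * derivative (δ * z ^ 2 - A) = 0)) :
    2 * z.natDegree ≤ 2 * d.natDegree + δ.natDegree + 4 * c.natDegree
      + max (4 * A.natDegree) (2 * c.natDegree) := by
  have h2' : (2 : k[X]) ≠ 0 := by
    intro h
    apply h2
    have : (C (2 : k)) = 0 := by rw [map_ofNat]; exact h
    exact C_eq_zero.1 this
  have n2 : (2 : k[X]).natDegree = 0 := by
    simp
  have n4 : (4 : k[X]).natDegree = 0 := by
    simp
  have h4' : (4 : k[X]) ≠ 0 := by
    have : (4 : k[X]) = 2 * 2 := by norm_num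
    rw [this]; exact mul_ne_zero h2' h2'
  have mulsub : ∀ (P Q : k[X]), (P * derivative Q).natDegree ≤ P.natDegree + Q.natDegree := by
    intro P Q
    have h1 := natDegree_mul_le (p := P) (q := derivative Q)
    have h3 := natDegree_derivative_le Q
    omega
  obtain ⟨w, hw⟩ : ∃ w, w = δ * z ^ 2 - A := ⟨_, rfl⟩
  obtain ⟨V, hV⟩ : ∃ V, V = A * derivative c - 2 * c * derivative A := ⟨_, rfl⟩
  obtain ⟨T, hT⟩ : ∃ T, T = w * derivative c - 2 * c * derivative w := ⟨_, rfl⟩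
  obtain ⟨m, hm⟩ : ∃ m, m = δ * z * derivative c
    - 2 * c * (derivative δ * z + 2 * δ * derivative z) := ⟨_, rfl⟩
  obtain ⟨g, hg⟩ : ∃ g, g = 2 * derivative w * d * y
    - w * (derivative d * y + 2 * d * derivative y) := ⟨_, rfl⟩
  obtain ⟨B, hBB⟩ : ∃ B, B = A ^ 2 - c := ⟨_, rfl⟩
  rw [← hw] at heq hns
  rw [← hV, ← hT] at hns
  rw [← hBB] at hB
  have hTg : T = y * g := by
    have h1 := congrArg derivative heq
    simp only [derivative_sub, derivative_mul, derivative_pow] at h1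
    simp only [Nat.cast_ofNat, Nat.add_one_sub_one, pow_one, map_ofNat] at h1
    rw [hT, hg]
    linear_combination (2 * derivative w) * heq - w * h1
  have hTm : T = z * m - V := by
    rw [hT, hm, hV, hw]
    simp only [derivative_sub, derivative_mul, derivative_pow]
    simp only [Nat.cast_ofNat, Nat.add_one_sub_one, pow_one, map_ofNat]
    ring
  have hmain : d * (z * m - V) ^ 2 = g ^ 2 * (δ ^ 2 * z ^ 4 - 2 * A * δ * z ^ 2 + B) := by
    rw [← hTm, hTg, hBB]
    rw [hw] at heq
    linear_combination (-g ^ 2) * heq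
  -- degrees
  have dz2 : (δ * z ^ 2).natDegree = δ.natDegree + 2 * z.natDegree := by
    rw [natDegree_mul hδ (pow_ne_zero _ hz), natDegree_pow]
  have dw : w.natDegree = δ.natDegree + 2 * z.natDegree := by
    rw [hw, natDegree_sub_eq_left_of_natDegree_lt (by omega), dz2]
  have dw2 : (w ^ 2).natDegree = 2 * w.natDegree := natDegree_pow _ _
  have dy : d.natDegree + 2 * y.natDegree = 2 * w.natDegree := by
    have h1 : (d * y ^ 2).natDegree = d.natDegree + 2 * y.natDegree := by
      rw [natDegree_mul hd (pow_ne_zero _ hy), natDegree_pow]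
    rw [← h1, ← heq, natDegree_sub_eq_left_of_natDegree_lt (by omega), dw2]
  have dT : T.natDegree ≤ w.natDegree + c.natDegree := by
    rw [hT]
    refine (natDegree_sub_le _ _).trans (max_le (mulsub _ _) ?_)
    have h1 := mulsub (2 * c) w
    have h3 := natDegree_mul_le (p := (2 : k[X])) (q := c)
    omega
  have dV : V.natDegree ≤ A.natDegree + c.natDegree := by
    rw [hV]
    refine (natDegree_sub_le _ _).trans (max_le (mulsub _ _) ?_)
    have h1 := mulsub (2 * c) A
    have h3 := natDegree_mul_le (p := (2 : k[X])) (q := c)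
    omega
  have dm : m.natDegree ≤ δ.natDegree + z.natDegree + c.natDegree := by
    rw [hm]
    refine (natDegree_sub_le _ _).trans (max_le ?_ ?_)
    · have h1 := mulsub (δ * z) c
      have h3 := natDegree_mul_le (p := δ) (q := z)
      omega
    · have h3 := natDegree_mul_le (p := (2 : k[X])) (q := c)
      have h5 := natDegree_mul_le (p := 2 * c)
        (q := (derivative δ * z + 2 * δ * derivative z))
      have h6 : (derivative δ * z + 2 * δ * derivative z).natDegree
          ≤ δ.natDegree + z.natDegree := by
        refine (natDegree_add_le _ _).trans (max_le ?_ ?_)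
        · rw [mul_comm]; have := mulsub z δ; omega
        · have := mulsub (2 * δ) z
          have := natDegree_mul_le (p := (2 : k[X])) (q := δ)
          omega
      omega
  have dB : B.natDegree ≤ max (2 * A.natDegree) c.natDegree := by
    rw [hBB]
    refine (natDegree_sub_le _ _).trans ?_
    rw [natDegree_pow]
  have dg : g ≠ 0 → 2 * g.natDegree ≤ 2 * c.natDegree + d.natDegree := by
    intro hg0
    have h1 : T.natDegree = y.natDegree + g.natDegree := by
      rw [hTg, natDegree_mul hy hg0]
    omega
  have dgB : g ≠ 0 → (g ^ 2 * B).natDegree ≤ 2 * c.natDegree + d.natDegree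
      + max (2 * A.natDegree) c.natDegree := by
    intro hg0
    have := dg hg0
    rw [natDegree_mul (pow_ne_zero _ hg0) hB, natDegree_pow]
    omega
  by_cases hV0 : V = 0
  · have hg0 : g ≠ 0 := by
      intro hg0
      exact hns ⟨hV0, by rw [hTg, hg0, mul_zero]⟩
    have hdvd : z ^ 2 ∣ g ^ 2 * B := by
      refine ⟨d * m ^ 2 - g ^ 2 * (δ ^ 2 * z ^ 2 - 2 * A * δ), ?_⟩
      rw [hV0] at hmain
      linear_combination -hmain
    have h1 := natDegree_le_of_dvd hdvd (mul_ne_zero (pow_ne_zero _ hg0) hB)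
    rw [natDegree_pow] at h1
    have := dgB hg0
    omega
  · by_cases hdeg : d * V ^ 2 = g ^ 2 * B
    · have hg0 : g ≠ 0 := by
        rintro rfl
        have : d * V ^ 2 ≠ 0 := mul_ne_zero hd (pow_ne_zero _ hV0)
        apply this; rw [hdeg]; ring
      have e1 : d * (z * m ^ 2 - 2 * m * V) = g ^ 2 * (δ ^ 2 * z ^ 3 - 2 * A * δ * z) := by
        apply mul_left_cancel₀ hz
        linear_combination hmain - hdeg
      have e2 : z ∣ 2 * d * V * m := by
        refine ⟨d * m ^ 2 - g ^ 2 * (δ ^ 2 * z ^ 2 - 2 * A * δ), ?_⟩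
        linear_combination -e1
      obtain ⟨κ, hκ⟩ := e2
      have e3 : z ^ 2 * (κ ^ 2 - 4 * d * V ^ 2 * g ^ 2 * δ ^ 2)
          = 4 * d * V ^ 2 * (κ - 2 * A * g ^ 2 * δ) := by
        apply mul_left_cancel₀ hz
        linear_combination (4 * d * V ^ 2) * e1 - z * (2 * d * V * m + z * κ) * hκ
          + 4 * d * V ^ 2 * hκ
      have hne : κ - 2 * A * g ^ 2 * δ ≠ 0 := by
        intro h0
        rw [h0, mul_zero] at e3
        have e4 : κ ^ 2 - 4 * d * V ^ 2 * g ^ 2 * δ ^ 2 = 0 :=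
          (mul_eq_zero.1 e3).resolve_left (pow_ne_zero _ hz)
        have e5 : 4 * (g ^ 4 * δ ^ 2) * c = 0 := by
          linear_combination e4 - (κ + 2 * A * g ^ 2 * δ) * h0
            + (4 * g ^ 2 * δ ^ 2) * hdeg + (4 * g ^ 4 * δ ^ 2) * hBB
        exact mul_ne_zero (mul_ne_zero h4' (mul_ne_zero (pow_ne_zero _ hg0)
          (pow_ne_zero _ hδ))) hc e5
      have hdvd : z ^ 2 ∣ 4 * d * V ^ 2 * (κ - 2 * A * g ^ 2 * δ) := ⟨_, e3.symm⟩
      have hne2 : 4 * d * V ^ 2 ≠ 0 := mul_ne_zero (mul_ne_zero h4' hd) (pow_ne_zero _ hV0)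
      have h1 := natDegree_le_of_dvd hdvd (mul_ne_zero hne2 hne)
      rw [natDegree_mul hne2 hne, natDegree_mul (mul_ne_zero h4' hd) (pow_ne_zero _ hV0),
        natDegree_mul h4' hd, n4, natDegree_pow, natDegree_pow] at h1
      have dκ : κ.natDegree ≤ d.natDegree + A.natDegree + δ.natDegree + 2 * c.natDegree := by
        by_cases hκ0 : κ = 0
        · simp [hκ0]
        have h3 : (2 * d * V * m).natDegree = z.natDegree + κ.natDegree := by
          rw [hκ, natDegree_mul hz hκ0]
        have h5 := natDegree_mul_le (p := 2 * d * V) (q := m)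
        have h6 := natDegree_mul_le (p := 2 * d) (q := V)
        have h7 := natDegree_mul_le (p := (2 : k[X])) (q := d)
        omega
      have dR : (2 * A * g ^ 2 * δ).natDegree ≤ A.natDegree + 2 * g.natDegree + δ.natDegree := by
        have h5 := natDegree_mul_le (p := 2 * A * g ^ 2) (q := δ)
        have h6 := natDegree_mul_le (p := 2 * A) (q := g ^ 2)
        have h7 := natDegree_mul_le (p := (2 : k[X])) (q := A)
        rw [natDegree_pow] at h6
        omega
      have h8 := natDegree_sub_le κ (2 * A * g ^ 2 * δ)
      have := dg hg0
      omega
    · have hne : d * V ^ 2 - g ^ 2 * B ≠ 0 := sub_ne_zero.2 hdeg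
      have hdvd : z ∣ d * V ^ 2 - g ^ 2 * B := by
        refine ⟨g ^ 2 * (δ ^ 2 * z ^ 3 - 2 * A * δ * z) - d * (z * m ^ 2 - 2 * m * V), ?_⟩
        linear_combination hmain
      have h1 := natDegree_le_of_dvd hdvd hne
      have h3 := natDegree_sub_le (d * V ^ 2) (g ^ 2 * B)
      have h5 : (d * V ^ 2).natDegree = d.natDegree + 2 * V.natDegree := by
        rw [natDegree_mul hd (pow_ne_zero _ hV0), natDegree_pow]
      have h6 : (g ^ 2 * B).natDegree ≤ 2 * c.natDegree + d.natDegree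
          + max (2 * A.natDegree) c.natDegree := by
        by_cases hg0 : g = 0
        · simp [hg0]
        · exact dgB hg0
      omega

lemma exists_sqfree_decomp {k : Type*} [Field k] (X : k[X]) (hX : X ≠ 0) :
    ∃ δ z : k[X], X = δ * z ^ 2 ∧ Squarefree δ := by
  induction hn : X.natDegree using Nat.strong_induction_on generalizing X with
  | _ n ih =>
    by_cases hs : Squarefree X
    · exact ⟨X, 1, by simp, hs⟩
    · unfold Squarefree at hs
      push Not at hs
      obtain ⟨a, ⟨b, hb⟩, hu⟩ := hs
      have ha0 : a ≠ 0 := by rintro rfl; simp at hb; exact hX hb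
      have hb0 : b ≠ 0 := by rintro rfl; simp at hb; exact hX hb
      have hda : a.natDegree ≠ 0 := by
        intro h0
        apply hu
        rw [isUnit_iff_degree_eq_zero, degree_eq_natDegree ha0, h0]; rfl
      have hdeg : X.natDegree = a.natDegree + a.natDegree + b.natDegree := by
        rw [hb, natDegree_mul (mul_ne_zero ha0 ha0) hb0, natDegree_mul ha0 ha0]
      obtain ⟨δ, z, h1, h2⟩ := ih b.natDegree (by omega) b hb0 rfl
      exact ⟨δ, z * a, by rw [hb, h1]; ring, h2⟩

lemma squarefree_natDegree {k : Type*} [Field k] [IsAlgClosed k] [DecidableEq k] (δ : k[X])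
    (h : Squarefree δ) : δ.natDegree = δ.roots.toFinset.card := by
  have h1 : δ.Separable := PerfectField.separable_iff_squarefree.2 h
  rw [Multiset.toFinset_card_of_nodup (nodup_roots h1)]
  exact (IsAlgClosed.splits δ).natDegree_eq_card_roots

/-- If `X^(2l+1) = h Y²` then `X = δ z²` with `δ` squarefree and supported on the roots of `h`. -/
lemma odd_pow_decomp {k : Type*} [Field k] [IsAlgClosed k] [DecidableEq k] (X h Y : k[X]) (l : ℕ)
    (hX : X ≠ 0) (heq : X ^ (2 * l + 1) = h * Y ^ 2) :
    ∃ δ z : k[X], X = δ * z ^ 2 ∧ δ.natDegree ≤ h.roots.toFinset.card := by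
  obtain ⟨δ, z, h1, h2⟩ := exists_sqfree_decomp X hX
  refine ⟨δ, z, h1, ?_⟩
  rw [squarefree_natDegree δ h2]
  apply Finset.card_le_card
  intro a ha
  rw [Multiset.mem_toFinset] at ha ⊢
  by_contra hcon
  have hsep : δ.Separable := PerfectField.separable_iff_squarefree.2 h2
  have c1 : Multiset.count a δ.roots = 1 :=
    Multiset.count_eq_one_of_mem (nodup_roots hsep) ha
  have c2 : Multiset.count a h.roots = 0 := Multiset.count_eq_zero_of_notMem hcon
  have hne : h * Y ^ 2 ≠ 0 := heq ▸ pow_ne_zero _ hX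
  have e1 := congrArg (fun P => Multiset.count a P.roots) heq
  have hX' := hX
  rw [h1] at hX'
  simp only [roots_mul hne, roots_pow] at e1
  rw [h1, roots_mul hX', roots_pow] at e1
  simp only [Multiset.count_add, Multiset.count_nsmul, c1, c2] at e1
  generalize Multiset.count a z.roots = r at e1
  generalize Multiset.count a Y.roots = s at e1
  have : 2 * (l + (2 * l + 1) * r) + 1 = 2 * s := by
    linarith
  omega

/-- A polynomial `Y` with `y ∣ Y^q` of controlled degree, supported on the roots of `y`. -/
lemma exists_root_cover {k : Type*} [Field k] [IsAlgClosed k] [DecidableEq k] (y : k[X])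
    (hy : y ≠ 0) (q : ℕ) (hq : 0 < q) :
    ∃ Y : k[X], Y ≠ 0 ∧ y ∣ Y ^ q ∧ Y.roots.toFinset ⊆ y.roots.toFinset ∧
      q * Y.natDegree ≤ y.natDegree + q * y.roots.toFinset.card := by
  let Y : k[X] := ∏ a ∈ y.roots.toFinset, (X - C a) ^ (y.roots.count a / q + 1)
  have hY0 : Y ≠ 0 := Finset.prod_ne_zero_iff.2 fun a _ => pow_ne_zero _ (X_sub_C_ne_zero a)
  have hdeg : Y.natDegree = ∑ a ∈ y.roots.toFinset, (y.roots.count a / q + 1) := by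
    rw [natDegree_prod _ _ fun a _ => pow_ne_zero _ (X_sub_C_ne_zero a)]
    refine Finset.sum_congr rfl fun a _ => ?_
    rw [natDegree_pow, natDegree_X_sub_C, mul_one]
  refine ⟨Y, hY0, ?_, ?_, ?_⟩
  · have hsplit := (IsAlgClosed.splits y).eq_prod_roots
    have hl : y.leadingCoeff ≠ 0 := leadingCoeff_ne_zero.2 hy
    rw [hsplit]
    rw [IsUnit.mul_left_dvd (isUnit_C.2 hl.isUnit)]
    rw [Finset.prod_multiset_map_count, ← Finset.prod_pow]
    refine Finset.prod_dvd_prod_of_dvd _ _ fun a _ => ?_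
    rw [← pow_mul]
    refine pow_dvd_pow _ ?_
    have := Nat.lt_div_mul_add (a := y.roots.count a) hq
    rw [add_mul, one_mul]
    exact this.le
  · intro a ha
    rw [Multiset.mem_toFinset, mem_roots hY0, IsRoot.def, eval_prod, Finset.prod_eq_zero_iff] at ha
    obtain ⟨b, hb, h0⟩ := ha
    have : a = b := by
      exact sub_eq_zero.1 (by simpa using h0)
    rw [this]; exact hb
  · rw [hdeg, (IsAlgClosed.splits y).natDegree_eq_card_roots, ← Multiset.toFinset_sum_count_eq,
      Finset.mul_sum, Finset.card_eq_sum_ones, Finset.mul_sum, ← Finset.sum_add_distrib]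
    refine Finset.sum_le_sum fun a _ => ?_
    have := Nat.mul_div_le (y.roots.count a) q
    rw [mul_add]
    omega

lemma exists_pth_root {k : Type*} [Field k] [IsAlgClosed k] (p : ℕ) [Fact p.Prime] [CharP k p]
    (f : k[X]) (hf : derivative f = 0) : ∃ g : k[X], g ^ p = f := by
  have hp : p ≠ 0 := (Fact.out : p.Prime).ne_zero
  have h1 := expand_contract p hf hp
  obtain ⟨g, hg⟩ : ∃ g : k[X], g.map (frobenius k p) = contract p f :=
    map_surjective _ (surjective_frobenius k p) _
  refine ⟨g, ?_⟩
  rw [← map_frobenius_expand p g, map_expand, hg, h1]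

lemma exists_pth_root_ratio {k : Type*} [Field k] [IsAlgClosed k] (p : ℕ) [Fact p.Prime]
    [CharP k p] (A c : k[X]) (hc : c ≠ 0)
    (h : A * derivative c - 2 * c * derivative A = 0) :
    ∃ f : RatFunc k, f ^ p = algebraMap k[X] (RatFunc k) A ^ 2 / algebraMap k[X] (RatFunc k) c := by
  obtain ⟨r, hr⟩ : ∃ r, p = r + 1 := ⟨p - 1, by have := (Fact.out : p.Prime).pos; omega⟩
  have hd : derivative (A ^ 2 * c ^ r) = 0 := by
    have hcast : ((r : ℕ) : k[X]) = -1 := by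
      have : ((p : ℕ) : k[X]) = 0 := CharP.cast_eq_zero _ _
      rw [hr] at this; push_cast at this
      linear_combination this
    obtain rfl | hr0 := Nat.eq_zero_or_pos r
    · exfalso; have := (Fact.out : p.Prime).one_lt; omega
    obtain ⟨s, rfl⟩ : ∃ s, r = s + 1 := ⟨r - 1, by omega⟩
    simp only [derivative_mul, derivative_pow, Nat.add_one_sub_one, pow_one, map_natCast, hcast]
    simp only [Nat.cast_ofNat]
    rw [pow_succ]
    linear_combination (-A * c ^ s) * h
  obtain ⟨g, hg⟩ := exists_pth_root p _ hd
  have hc' : algebraMap k[X] (RatFunc k) c ≠ 0 := by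
    simpa using hc
  refine ⟨algebraMap _ _ g / algebraMap _ _ c, ?_⟩
  rw [div_pow, ← map_pow, hg, hr, map_mul, map_pow, map_pow]
  field_simp
  ring

/-- Root extraction for polynomials. -/
lemma poly_root {k : Type*} [Field k] (f : k[X]) (q : ℕ) (hq : 0 < q) (r : RatFunc k)
    (h : r ^ q = algebraMap k[X] (RatFunc k) f) : ∃ g : k[X], g ^ q = f ∧ algebraMap _ _ g = r := by
  obtain ⟨g, hg⟩ := IsIntegrallyClosed.exists_algebraMap_eq_of_isIntegral_pow (R := k[X]) hq
    (h ▸ isIntegral_algebraMap)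
  refine ⟨g, ?_, hg⟩
  apply IsFractionRing.injective k[X] (RatFunc k)
  rw [map_pow, hg, h]

lemma odd_root {K : Type*} [Field K] (u f : K) (l : ℕ) (h : f ^ (2 * l + 1) = u ^ 2) :
    ∃ g : K, g ^ (2 * l + 1) = u := by
  by_cases hu : u = 0
  · exact ⟨0, by simp [hu]⟩
  have hf : f ≠ 0 := by
    rintro rfl
    rw [zero_pow (by omega)] at h
    exact hu (pow_eq_zero_iff (by norm_num) |>.1 h.symm)
  refine ⟨u / f ^ l, ?_⟩
  rw [div_pow, ← pow_mul, mul_comm l, pow_mul, h, ← pow_mul, pow_succ, mul_div_assoc]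
  field_simp

lemma star_root {k : Type*} [Field k] (w c c' h : k[X]) (l : ℕ) (hc : c ≠ 0)
    (hh : c' ^ (2 * l + 1) = h ^ 2 * c) (f : RatFunc k)
    (hf : f ^ (2 * l + 1) = algebraMap k[X] (RatFunc k) w ^ 2 / algebraMap k[X] (RatFunc k) c) :
    ∃ w' : k[X], w' ^ (2 * l + 1) = w * h := by
  have hc' : algebraMap k[X] (RatFunc k) c ≠ 0 := by
    simpa using hc
  obtain ⟨g, hg⟩ := odd_root (algebraMap k[X] (RatFunc k) (w * h))
    (algebraMap k[X] (RatFunc k) c' * f) l (by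
      rw [mul_pow, hf, ← map_pow, hh, map_mul, map_mul, map_pow]
      field_simp)
  obtain ⟨w', h1, -⟩ := poly_root _ _ (by omega) g hg
  exact ⟨w', h1⟩

lemma pow_char_inj {R : Type*} [CommRing R] [IsDomain R] (p : ℕ) [Fact p.Prime] [CharP R p]
    (e : ℕ) (a b : R) (h : a ^ p ^ e = b ^ p ^ e) : a = b := by
  have h1 := sub_pow_char_pow a b e (p := p)
  rw [h, sub_self] at h1
  exact sub_eq_zero.1 (eq_zero_of_pow_eq_zero h1)

/-- In the isotrivial-twist case, the orbit has inseparability degree exactly that of `c₁`. -/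
lemma dyn_case3 {k : Type*} [Field k] [IsAlgClosed k] (p : ℕ) [Fact p.Prime] [CharP k p]
    (hodd : p ≠ 2) (e : ℕ) (y A : k[X]) (a : k) (ha : a ≠ 0) (hA : A = C a * y)
    (hy : 0 < y.natDegree) (W : ℕ → k[X]) (hW1 : W 1 = -A)
    (hW : ∀ m, 1 ≤ m → W (m + 1) = W m ^ 2 - A)
    (he : ∃ f : RatFunc k, f ^ p ^ e = algebraMap k[X] _ (y ^ 2))
    (he' : ¬ ∃ f : RatFunc k, f ^ p ^ (e + 1) = algebraMap k[X] _ (y ^ 2))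
    (m : ℕ) (hm : 2 ≤ m) :
    ¬ ∃ f : RatFunc k, f ^ p ^ (e + 1) =
      algebraMap k[X] (RatFunc k) (W m) ^ 2 / algebraMap k[X] (RatFunc k) (y ^ 2) := by
  have hpo : Odd p := (Fact.out : p.Prime).odd_of_ne_two hodd
  have hp0 : 0 < p := (Fact.out : p.Prime).pos
  have hy0 : y ≠ 0 := by rintro rfl; simp at hy
  rintro ⟨f, hf⟩
  obtain ⟨σ, hσ⟩ : ∃ σ : k[X], σ ^ p ^ e = y := by
    obtain ⟨f0, hf0⟩ := he
    obtain ⟨l, hl⟩ := hpo.pow (n := e)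
    rw [hl, map_pow] at hf0
    obtain ⟨g, hg⟩ := odd_root _ _ _ hf0
    obtain ⟨σ, h1, -⟩ := poly_root _ _ (by omega) g hg
    exact ⟨σ, by rw [hl]; exact h1⟩
  obtain ⟨α, hα⟩ : ∃ α : k, α ^ p ^ e = a :=
    IsAlgClosed.exists_pow_nat_eq a (pow_pos hp0 e)
  have hα0 : α ≠ 0 := by
    rintro rfl
    rw [zero_pow (pow_pos hp0 e).ne'] at hα
    exact ha hα.symm
  let Q : ℕ → k[X] := fun j => Nat.rec (-C α) (fun _ P => X * P ^ 2 - C α) j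
  have hQ0 : Q 0 = -C α := rfl
  have hQs : ∀ j, Q (j + 1) = X * Q j ^ 2 - C α := fun _ => rfl
  have hWQ : ∀ j, W (j + 1) = y * ((Q j).comp σ) ^ p ^ e := by
    intro j
    induction j with
    | zero =>
      rw [hW1, hQ0, hA, ← hα]
      simp only [neg_comp, C_comp]
      rw [((hpo.pow (n := e))).neg_pow, ← C_pow]
      ring
    | succ j ih =>
      rw [hW (j + 1) (by omega), ih, hQs, hA, ← hα]
      simp only [sub_comp, mul_comp, X_comp, pow_comp, C_comp]
      rw [sub_pow_char_pow, mul_pow σ, hσ, ← C_pow]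
      ring
  have hc0 : ∀ j, (Q j).coeff 0 = -α := by
    intro j
    cases j with
    | zero => rw [hQ0]; simp
    | succ j => rw [hQs]; simp
  obtain ⟨j, rfl⟩ : ∃ j, m = j + 2 := ⟨m - 2, by omega⟩
  have hc1 : (Q (j + 1)).coeff 1 = α ^ 2 := by
    rw [hQs, coeff_sub, coeff_X_mul, coeff_C, if_neg one_ne_zero, sub_zero, coeff_zero_eq_eval_zero,
      eval_pow, ← coeff_zero_eq_eval_zero, hc0]
    ring
  have hy' : algebraMap k[X] (RatFunc k) y ≠ 0 := by simpa using hy0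
  obtain ⟨G, hG⟩ : ∃ G : k[X], G ^ p ^ (e + 1) = ((Q (j + 1)).comp σ) ^ p ^ e := by
    obtain ⟨l, hl⟩ := hpo.pow (n := e + 1)
    rw [hWQ (j + 1), map_mul, map_pow _ y, mul_pow, mul_div_cancel_left₀ _ (pow_ne_zero _ hy'),
      hl] at hf
    obtain ⟨g, hg⟩ := odd_root _ _ _ hf
    obtain ⟨σ, h1, -⟩ := poly_root _ _ (by omega) g hg
    exact ⟨σ, by rw [hl]; exact h1⟩
  have hG' : G ^ p = (Q (j + 1)).comp σ := by
    apply pow_char_inj p e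
    rw [← hG, ← pow_mul, pow_succ, mul_comm]
  have hder : derivative ((Q (j + 1)).comp σ) = 0 := by
    rw [← hG', derivative_pow]
    simp
  rw [derivative_comp] at hder
  rcases mul_eq_zero.1 hder with h | h
  · obtain ⟨τ, hτ⟩ := exists_pth_root p σ h
    apply he'
    refine ⟨algebraMap _ _ (τ ^ 2), ?_⟩
    rw [← map_pow, ← hσ, ← hτ]
    congr 1
    rw [pow_succ]
    ring
  · rcases comp_eq_zero_iff.1 h with h | ⟨-, h⟩
    · have := congrArg (fun P => coeff P 0) h
      simp only [coeff_derivative, coeff_zero, zero_add, hc1] at this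
      simp [hα0] at this
    · rw [← hσ, h, ← C_pow, natDegree_C] at hy
      exact lt_irrefl _ hy

lemma lift_root {k : Type*} [Field k] (p j l : ℕ) (hl : p ^ j = 2 * l + 1)
    (w c w' c' h : k[X]) (hh0 : h ≠ 0)
    (hh : c' ^ (2 * l + 1) = h ^ 2 * c) (hw : w' ^ (2 * l + 1) = w * h)
    (hf : ∃ f : RatFunc k,
      f ^ p = algebraMap k[X] (RatFunc k) w' ^ 2 / algebraMap k[X] (RatFunc k) c') :
    ∃ f : RatFunc k,
      f ^ p ^ (j + 1) = algebraMap k[X] (RatFunc k) w ^ 2 / algebraMap k[X] (RatFunc k) c := by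
  obtain ⟨f, hf⟩ := hf
  refine ⟨f, ?_⟩
  have hh' : algebraMap k[X] (RatFunc k) h ≠ 0 := by simpa using hh0
  rw [pow_succ, mul_comm, pow_mul, hf, hl, div_pow, ← map_pow _ c', hh, ← pow_mul, mul_comm 2,
    pow_mul, ← map_pow, hw, map_mul, map_mul, map_pow, mul_pow, mul_comm (_ ^ 2)]
  exact mul_div_mul_left _ _ (pow_ne_zero _ hh')

lemma final_arith (q δ ζ H z a' a c' c D R d₁ : ℕ) (qδ : q * (δ + 2 * ζ) = H + 2 * z)
    (qA : q * a' = a + H) (qc : q * c' = 2 * H + c) (hH : 2 * H ≤ q * (d₁ + 2 * R))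
    (key : δ + 2 * ζ ≤ 2 * D + 2 * R + 4 * c' + max (4 * a') (2 * c')) :
    2 * z ≤ q * (2 * D + 14 * R + 6 * d₁) + 4 * c + max (4 * a) (2 * c) := by
  have key3 := Nat.mul_le_mul_left q key
  rcases max_cases (4 * a') (2 * c') with ⟨hm, -⟩ | ⟨hm, -⟩
  · rw [hm] at key3
    have := le_max_left (4 * a) (2 * c)
    linarith
  · rw [hm] at key3
    have := le_max_right (4 * a) (2 * c)
    linarith

lemma main_bound {k : Type*} [Field k] [IsAlgClosed k] [DecidableEq k] (p : ℕ) [Fact p.Prime]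
    [CharP k p] (hodd : p ≠ 2) (j : ℕ) (w z A c d y d₁ y₁ : k[X]) (hw : w = z ^ 2 - A)
    (heq : w ^ 2 - c = d * y ^ 2) (hc₁ : c = d₁ * y₁ ^ 2) (hc : c ≠ 0) (hB : A ^ 2 - c ≠ 0)
    (hω : ∃ f : RatFunc k, f ^ p ^ j =
      algebraMap k[X] (RatFunc k) w ^ 2 / algebraMap k[X] (RatFunc k) c)
    (hυ : ∃ f : RatFunc k, f ^ p ^ j =
      algebraMap k[X] (RatFunc k) A ^ 2 / algebraMap k[X] (RatFunc k) c)
    (hnot : ¬ ((∃ f : RatFunc k, f ^ p ^ (j + 1) =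
        algebraMap k[X] (RatFunc k) w ^ 2 / algebraMap k[X] (RatFunc k) c) ∧
      (∃ f : RatFunc k, f ^ p ^ (j + 1) =
        algebraMap k[X] (RatFunc k) A ^ 2 / algebraMap k[X] (RatFunc k) c)))
    (hA0 : A ≠ 0)
    (hdA : A.natDegree < 2 * z.natDegree) (hdc : c.natDegree < 4 * z.natDegree) :
    2 * z.natDegree ≤ p ^ j * (2 * d.natDegree + 14 * c.roots.toFinset.card + 6 * d₁.natDegree)
      + 4 * c.natDegree + max (4 * A.natDegree) (2 * c.natDegree) := by
  have hpo : Odd p := (Fact.out : p.Prime).odd_of_ne_two hodd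
  have hp0 : 0 < p := (Fact.out : p.Prime).pos
  obtain ⟨l, hl⟩ := hpo.pow (n := j)
  have hz : z ≠ 0 := by rintro rfl; simp at hdA
  have hd₁0 : d₁ ≠ 0 := by rintro rfl; simp at hc₁; exact hc hc₁
  have hy₁0 : y₁ ≠ 0 := by rintro rfl; simp at hc₁; exact hc hc₁
  have dz2 : (z ^ 2).natDegree = 2 * z.natDegree := natDegree_pow _ _
  have dw : w.natDegree = 2 * z.natDegree := by
    rw [hw, natDegree_sub_eq_left_of_natDegree_lt (by omega), dz2]
  have hw0 : w ≠ 0 := by rintro rfl; simp at dw; simp [dw] at hdA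
  have hE0 : w ^ 2 - c ≠ 0 := by
    intro h
    rw [sub_eq_zero] at h
    have : (w ^ 2).natDegree = 2 * w.natDegree := natDegree_pow _ _
    rw [h] at this
    omega
  have hd0 : d ≠ 0 := by rintro rfl; apply hE0; rw [heq]; ring
  have hy0 : y ≠ 0 := by rintro rfl; apply hE0; rw [heq]; ring
  obtain ⟨Y, hY0, ⟨H, hH⟩, hYr, hYd⟩ := exists_root_cover y₁ hy₁0 (p ^ j) (pow_pos hp0 j)
  have hH0 : H ≠ 0 := by
    rintro rfl
    rw [mul_zero] at hH
    exact hY0 (eq_zero_of_pow_eq_zero hH)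
  obtain ⟨h, hh⟩ : ∃ h, h = d₁ ^ l * H := ⟨_, rfl⟩
  have hh0 : h ≠ 0 := by rw [hh]; exact mul_ne_zero (pow_ne_zero _ hd₁0) hH0
  obtain ⟨c', hc'⟩ : ∃ c', c' = d₁ * Y ^ 2 := ⟨_, rfl⟩
  have hc'0 : c' ≠ 0 := by rw [hc']; exact mul_ne_zero hd₁0 (pow_ne_zero _ hY0)
  have hcc : c' ^ (2 * l + 1) = h ^ 2 * c := by
    rw [hc', hh, hc₁, mul_pow, ← pow_mul Y, mul_comm 2 (2 * l + 1), pow_mul Y,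
      ← hl, hH, hl]
    ring
  -- roots of h are roots of c
  have hroots : h.roots.toFinset.card ≤ c.roots.toFinset.card := by
    apply Finset.card_le_card
    intro a ha
    rw [Multiset.mem_toFinset, mem_roots hh0, IsRoot.def, hh, eval_mul, eval_pow] at ha
    rw [Multiset.mem_toFinset, mem_roots hc, IsRoot.def, hc₁, eval_mul, eval_pow]
    rcases mul_eq_zero.1 ha with h1 | h1
    · rw [eq_zero_of_pow_eq_zero h1, zero_mul]
    · have h3 : eval a Y = 0 := by
        have h4 : eval a (Y ^ p ^ j) = 0 := by rw [hH, eval_mul, h1, mul_zero]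
        rw [eval_pow] at h4
        exact eq_zero_of_pow_eq_zero h4
      have h5 : a ∈ y₁.roots.toFinset := by
        apply hYr
        rw [Multiset.mem_toFinset, mem_roots hY0]
        exact h3
      rw [Multiset.mem_toFinset, mem_roots hy₁0, IsRoot.def] at h5
      rw [h5]; ring
  have hyroots : y₁.roots.toFinset.card ≤ c.roots.toFinset.card := by
    apply Finset.card_le_card
    intro a ha
    rw [Multiset.mem_toFinset, mem_roots hy₁0, IsRoot.def] at ha
    rw [Multiset.mem_toFinset, mem_roots hc, IsRoot.def, hc₁, eval_mul, eval_pow, ha]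
    ring
  obtain ⟨w', hw'⟩ : ∃ w' : k[X], w' ^ (2 * l + 1) = w * h := by
    obtain ⟨f, hf⟩ := hω
    rw [hl] at hf
    exact star_root w c c' h l hc hcc f hf
  obtain ⟨A', hA'⟩ : ∃ w' : k[X], w' ^ (2 * l + 1) = A * h := by
    obtain ⟨f, hf⟩ := hυ
    rw [hl] at hf
    exact star_root A c c' h l hc hcc f hf
  have hx : (w' + A') ^ (2 * l + 1) = h * z ^ 2 := by
    rw [← hl, add_pow_char_pow, hl, hw', hA', hw]; ring
  have hx0 : w' + A' ≠ 0 := by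
    intro h0
    rw [h0, zero_pow (by omega)] at hx
    exact mul_ne_zero hh0 (pow_ne_zero _ hz) hx.symm
  obtain ⟨δ, ζ, hδζ, hδd⟩ := odd_pow_decomp _ _ _ _ hx0 hx
  have hδ0 : δ ≠ 0 := by rintro rfl; simp at hδζ; exact hx0 hδζ
  have hζ0 : ζ ≠ 0 := by rintro rfl; simp at hδζ; exact hx0 hδζ
  have hE : (w' ^ 2 - c') ^ (2 * l + 1) = d * (h * y) ^ 2 := by
    rw [← hl, sub_pow_char_pow, hl, hcc, ← pow_mul, mul_comm 2, pow_mul, hw']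
    linear_combination h ^ 2 * heq
  have hE'0 : w' ^ 2 - c' ≠ 0 := by
    intro h0
    rw [h0, zero_pow (by omega)] at hE
    exact mul_ne_zero hd0 (pow_ne_zero _ (mul_ne_zero hh0 hy0)) hE.symm
  obtain ⟨d', y', hdy, hd'⟩ := odd_pow_decomp _ _ _ _ hE'0 hE
  have hd'0 : d' ≠ 0 := by rintro rfl; simp at hdy; exact hE'0 hdy
  have hy'0 : y' ≠ 0 := by rintro rfl; simp at hdy; exact hE'0 hdy
  have hdd : d'.natDegree ≤ d.natDegree :=
    hd'.trans ((Multiset.toFinset_card_le _).trans (card_roots' d))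
  have hww : w' = δ * ζ ^ 2 - A' := by rw [← hδζ]; ring
  have hB' : A' ^ 2 - c' ≠ 0 := by
    intro h0
    have h1 : (A' ^ 2 - c') ^ (2 * l + 1) = h ^ 2 * (A ^ 2 - c) := by
      rw [← hl, sub_pow_char_pow, hl, hcc, ← pow_mul, mul_comm 2, pow_mul, hA']
      ring
    rw [h0, zero_pow (by omega)] at h1
    exact mul_ne_zero (pow_ne_zero _ hh0) hB h1.symm
  -- degrees
  have qδ : (2 * l + 1) * (δ.natDegree + 2 * ζ.natDegree) = h.natDegree + 2 * z.natDegree := by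
    have := congrArg natDegree hx
    rw [hδζ, natDegree_pow, natDegree_mul hδ0 (pow_ne_zero _ hζ0), natDegree_pow,
      natDegree_mul hh0 (pow_ne_zero _ hz), natDegree_pow] at this
    exact this
  have qA : (2 * l + 1) * A'.natDegree = A.natDegree + h.natDegree := by
    have := congrArg natDegree hA'
    rw [natDegree_pow, natDegree_mul hA0 hh0] at this
    exact this
  have qc : (2 * l + 1) * c'.natDegree = 2 * h.natDegree + c.natDegree := by
    have := congrArg natDegree hcc
    rw [natDegree_pow, natDegree_mul (pow_ne_zero _ hh0) hc, natDegree_pow] at this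
    exact this
  have dc : c.natDegree = d₁.natDegree + 2 * y₁.natDegree := by
    rw [hc₁, natDegree_mul hd₁0 (pow_ne_zero _ hy₁0), natDegree_pow]
  have dc' : c'.natDegree = d₁.natDegree + 2 * Y.natDegree := by
    rw [hc', natDegree_mul hd₁0 (pow_ne_zero _ hY0), natDegree_pow]
  have h2 : (2 : k) ≠ 0 := by
    intro h0
    have : ((2 : ℕ) : k) = 0 := by exact_mod_cast h0
    rw [CharP.cast_eq_zero_iff k p] at this
    have := Nat.le_of_dvd (by norm_num) this
    have := (Fact.out : p.Prime).two_le
    omega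
  have key := core_bound h2 δ ζ A' c' d' y' hδ0 hζ0 hc'0 hB' hd'0 hy'0
    (by rw [← hww]; exact hdy)
    (by nlinarith) (by nlinarith)
    (by
      rintro ⟨hV, hT⟩
      rw [← hww] at hT
      exact hnot ⟨lift_root p j l hl w c w' c' h hh0 hcc hw' (exists_pth_root_ratio p w' c' hc'0 hT),
        lift_root p j l hl A c A' c' h hh0 hcc hA' (exists_pth_root_ratio p A' c' hc'0 hV)⟩)
  rw [hl] at hYd ⊢
  generalize c.roots.toFinset.card = R at *
  -- bound on deg h
  have hHb : 2 * h.natDegree ≤ (2 * l + 1) * (d₁.natDegree + 2 * R) := by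
    have h1 : (2 * l + 1) * y₁.roots.toFinset.card ≤ (2 * l + 1) * R :=
      Nat.mul_le_mul_left _ hyroots
    rw [dc', dc] at qc
    nlinarith
  have hδR : δ.natDegree ≤ R := hδd.trans hroots
  have key2 : δ.natDegree + 2 * ζ.natDegree ≤ 2 * d.natDegree + 2 * R + 4 * c'.natDegree
      + max (4 * A'.natDegree) (2 * c'.natDegree) := by omega
  exact final_arith (2 * l + 1) _ _ _ _ _ _ _ _ _ _ _ qδ qA qc hHb key2

/-- main height bound: Let `p` be odd and `φ = (x - γ)² - c₁ ∈ 𝔽̄_p[t][x]`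
non-isotrivial (`deg (γ + c₁) > 0`), `c₁ ≠ 0`, `γ + c₁ ± √c₁ ≠ 0`, with dynamical
inseparability degree `e`.  Write `cₙ = dₙ yₙ²` with `dₙ` squarefree.  If `n ≥ 3` satisfies
`deg (γ + c₁) · 2^(n-3) > h(φ) = max (deg γ) (deg c₁)`, then
`deg c_{n-1} ≤ 8 p^e deg dₙ + 8 p^e (deg d₁ + 4 + 4 deg (rad c₁) + 4 deg (rad c₂))
   + 4 deg γ + 8 deg c₁`. -/
theorem stmt_5 (p : ℕ) [Fact p.Prime] (hodd : p ≠ 2)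
    (γ c₁ : Polynomial (AlgebraicClosure (ZMod p)))
    (hc₁ : c₁ ≠ 0) (hiso : 0 < (γ + c₁).natDegree)
    (c : ℕ → Polynomial (AlgebraicClosure (ZMod p)))
    (hc1 : c 1 = c₁)
    (hcn : ∀ m, 2 ≤ m → c m = (fun x => (x - γ) ^ 2 - c₁)^[m] γ)
    -- γ + c₁ ± √c₁ ≠ 0 (for any square root of c₁ in 𝔽̄_p(t))
    (hnonsing : ∀ r : RatFunc (AlgebraicClosure (ZMod p)),
      r ^ 2 = algebraMap (Polynomial (AlgebraicClosure (ZMod p))) _ c₁ →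
      algebraMap (Polynomial (AlgebraicClosure (ZMod p))) _ (γ + c₁) + r ≠ 0)
    -- `e` is the dynamical inseparability degree of φ
    (e : ℕ)
    (he :
      (¬ (∃ y : Polynomial (AlgebraicClosure (ZMod p)), y ^ 2 = c₁) ∧
        (∃ f : RatFunc (AlgebraicClosure (ZMod p)), f ^ p ^ e =
          algebraMap (Polynomial _) _ (c 2) / algebraMap (Polynomial _) _ c₁) ∧
        ¬ (∃ f : RatFunc (AlgebraicClosure (ZMod p)), f ^ p ^ (e + 1) =
          algebraMap (Polynomial _) _ (c 2) / algebraMap (Polynomial _) _ c₁)) ∨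
      (∃ y : Polynomial (AlgebraicClosure (ZMod p)), y ^ 2 = c₁ ∧
        ¬ (∃ a : AlgebraicClosure (ZMod p),
          algebraMap (Polynomial _) _ γ / algebraMap (Polynomial _) _ y +
            algebraMap (Polynomial _) _ y = RatFunc.C a) ∧
        (∃ f : RatFunc (AlgebraicClosure (ZMod p)), f ^ p ^ e =
          algebraMap (Polynomial _) _ γ / algebraMap (Polynomial _) _ y +
            algebraMap (Polynomial _) _ y) ∧
        ¬ (∃ f : RatFunc (AlgebraicClosure (ZMod p)), f ^ p ^ (e + 1) =
          algebraMap (Polynomial _) _ γ / algebraMap (Polynomial _) _ y +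
            algebraMap (Polynomial _) _ y)) ∨
      (∃ y : Polynomial (AlgebraicClosure (ZMod p)), y ^ 2 = c₁ ∧
        (∃ a : AlgebraicClosure (ZMod p),
          algebraMap (Polynomial _) _ γ / algebraMap (Polynomial _) _ y +
            algebraMap (Polynomial _) _ y = RatFunc.C a) ∧
        (∃ f : RatFunc (AlgebraicClosure (ZMod p)), f ^ p ^ e =
          algebraMap (Polynomial _) _ c₁) ∧
        ¬ (∃ f : RatFunc (AlgebraicClosure (ZMod p)), f ^ p ^ (e + 1) =
          algebraMap (Polynomial _) _ c₁)))
    (n : ℕ) (hn : 3 ≤ n)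
    (hbig : max γ.natDegree c₁.natDegree < (γ + c₁).natDegree * 2 ^ (n - 3))
    -- squarefree decompositions cₙ = dₙ yₙ², c₁ = d₁ y₁²
    (d y d₁ y₁ : Polynomial (AlgebraicClosure (ZMod p)))
    (hd : c n = d * y ^ 2) (hdsf : Squarefree d)
    (hd₁ : c₁ = d₁ * y₁ ^ 2) (hd₁sf : Squarefree d₁)
    -- radicals of c₁ and c₂ : squarefree polynomials with the same irreducible divisors
    (rc₁ rc₂ : Polynomial (AlgebraicClosure (ZMod p)))
    (hrc₁ : Squarefree rc₁ ∧ ∀ q : Polynomial (AlgebraicClosure (ZMod p)),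
      Irreducible q → (q ∣ rc₁ ↔ q ∣ c₁))
    (hrc₂ : Squarefree rc₂ ∧ ∀ q : Polynomial (AlgebraicClosure (ZMod p)),
      Irreducible q → (q ∣ rc₂ ↔ q ∣ c 2)) :
    (c (n - 1)).natDegree ≤
      8 * p ^ e * d.natDegree +
        (8 * p ^ e * (d₁.natDegree + 4 + 4 * rc₁.natDegree +
          4 * rc₂.natDegree) +
          4 * γ.natDegree + 8 * c₁.natDegree) := by
  classical
  have hpo : Odd p := (Fact.out : p.Prime).odd_of_ne_two hodd
  have hp0 : 0 < p := (Fact.out : p.Prime).pos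
  obtain ⟨A, hA⟩ : ∃ A, A = γ + c₁ := ⟨_, rfl⟩
  have hA0 : A ≠ 0 := by rintro rfl; rw [← hA] at hiso; simp at hiso
  have hc₁' : algebraMap (Polynomial (AlgebraicClosure (ZMod p))) (RatFunc (AlgebraicClosure (ZMod p))) c₁ ≠ 0 := by
    simpa using hc₁
  -- the shifted orbit
  obtain ⟨W, hWdef⟩ : ∃ W : ℕ → Polynomial (AlgebraicClosure (ZMod p)),
      W = fun m => (fun x => (x - γ) ^ 2 - c₁)^[m] γ - γ := ⟨_, rfl⟩
  have hWc : ∀ m, (fun x => (x - γ) ^ 2 - c₁)^[m + 1] γ = W m ^ 2 - c₁ := by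
    intro m
    rw [Function.iterate_succ_apply', hWdef]
  have hW1 : W 1 = -A := by
    rw [hWdef, hA]; simp; ring
  have hW : ∀ m, 1 ≤ m → W (m + 1) = W m ^ 2 - A := by
    intro m _
    have h1 := hWc m
    have h2 : W (m + 1) = (fun x => (x - γ) ^ 2 - c₁)^[m + 1] γ - γ := by rw [hWdef]
    rw [h2, h1, hA]; ring
  have hc2 : c 2 = A ^ 2 - c₁ := by
    rw [hcn 2 le_rfl, hWc 1, hW1]; ring
  have hB : A ^ 2 - c₁ ≠ 0 := by
    intro h0
    refine hnonsing (-algebraMap _ _ A) ?_ ?_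
    · rw [neg_sq, ← map_pow, sub_eq_zero.1 h0]
    · rw [hA]; ring
  obtain ⟨N, rfl⟩ : ∃ N, n = N + 3 := ⟨n - 3, by omega⟩
  have hcn0 : c (N + 3) = W (N + 2) ^ 2 - c₁ := by
    rw [hcn _ (by omega), hWc]
  have hcn1 : c (N + 3 - 1) = W (N + 1) ^ 2 - c₁ := by
    rw [show N + 3 - 1 = N + 1 + 1 from rfl, hcn _ (by omega), hWc]
  obtain ⟨S, hS⟩ : ∃ S : ℕ → Prop, S = fun j =>
      (∃ f : RatFunc (AlgebraicClosure (ZMod p)), f ^ p ^ j =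
        algebraMap (Polynomial (AlgebraicClosure (ZMod p))) (RatFunc (AlgebraicClosure (ZMod p))) (W (N + 2)) ^ 2
          / algebraMap (Polynomial (AlgebraicClosure (ZMod p))) (RatFunc (AlgebraicClosure (ZMod p))) c₁) ∧
      (∃ f : RatFunc (AlgebraicClosure (ZMod p)), f ^ p ^ j =
        algebraMap (Polynomial (AlgebraicClosure (ZMod p))) (RatFunc (AlgebraicClosure (ZMod p))) A ^ 2
          / algebraMap (Polynomial (AlgebraicClosure (ZMod p))) (RatFunc (AlgebraicClosure (ZMod p))) c₁) := ⟨_, rfl⟩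
  have hS0 : S 0 := by rw [hS]; exact ⟨⟨_, by rw [pow_zero, pow_one]⟩, ⟨_, by rw [pow_zero, pow_one]⟩⟩
  have hSe : ¬ S (e + 1) := by
    rw [hS]
    rintro ⟨hw, f, hf⟩
    rcases he with ⟨-, -, hne⟩ | ⟨s, hs, -, -, hne⟩ | ⟨s, hs, ⟨a, ha⟩, h1, hne⟩
    · apply hne
      refine ⟨f - 1, ?_⟩
      rw [sub_pow_char_pow, hf, one_pow, hc2, map_sub, map_pow, sub_div, div_self hc₁']
    · apply hne
      have hs0 : s ≠ 0 := by rintro rfl; apply hc₁; rw [← hs]; ring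
      have hs' : algebraMap (Polynomial (AlgebraicClosure (ZMod p))) (RatFunc (AlgebraicClosure (ZMod p))) s ≠ 0 := by
        simpa using hs0
      obtain ⟨l, hl⟩ := hpo.pow (n := e + 1)
      rw [hl] at hf ⊢
      apply odd_root _ f
      rw [hf, hA, ← hs, map_add, map_pow]
      field_simp
    · have hs0 : s ≠ 0 := by rintro rfl; apply hc₁; rw [← hs]; ring
      have hs' : algebraMap (Polynomial (AlgebraicClosure (ZMod p))) (RatFunc (AlgebraicClosure (ZMod p))) s ≠ 0 := by
        simpa using hs0
      have hAs : A = C a * s := by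
        apply IsFractionRing.injective (Polynomial (AlgebraicClosure (ZMod p)))
          (RatFunc (AlgebraicClosure (ZMod p)))
        rw [hA, map_mul, RatFunc.algebraMap_C, ← ha, ← hs, map_add, map_pow]
        field_simp
      have ha0 : a ≠ 0 := by rintro rfl; apply hA0; rw [hAs]; simp
      have hsd : 0 < s.natDegree := by
        rw [← hA, hAs, natDegree_C_mul ha0] at hiso
        exact hiso
      rw [← hs] at h1 hne hw
      exact dyn_case3 p hodd e s A a ha0 hAs hsd W hW1 hW h1 hne (N + 2)
        (by omega) hw
  obtain ⟨j, hje, hj, hj1⟩ : ∃ j, j ≤ e ∧ S j ∧ ¬ S (j + 1) := by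
    by_contra hcon
    push Not at hcon
    have : ∀ j, j ≤ e + 1 → S j := by
      intro j
      induction j with
      | zero => intro _; exact hS0
      | succ j ih => intro hj; exact hcon j (by omega) (ih (by omega))
    exact hSe (this _ le_rfl)
  rw [hS] at hj hj1
  have hdegc : (c (N + 3 - 1)).natDegree ≤ max (2 * (W (N + 1)).natDegree) c₁.natDegree := by
    rw [hcn1]
    refine (natDegree_sub_le _ _).trans ?_
    rw [natDegree_pow]
  have hdegA : A.natDegree ≤ max γ.natDegree c₁.natDegree := by
    rw [hA]; exact natDegree_add_le _ _
  have hR : c₁.roots.toFinset.card ≤ rc₁.natDegree := by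
    refine le_trans ?_ ((Multiset.toFinset_card_le rc₁.roots).trans (card_roots' rc₁))
    apply Finset.card_le_card
    intro a ha
    rw [Multiset.mem_toFinset, mem_roots hc₁, ← dvd_iff_isRoot] at ha
    rw [Multiset.mem_toFinset, mem_roots hrc₁.1.ne_zero, ← dvd_iff_isRoot]
    exact (hrc₁.2 _ (irreducible_X_sub_C a)).2 ha
  have hpe : p ^ j ≤ p ^ e := Nat.pow_le_pow_right hp0 hje
  by_cases hdA : A.natDegree < 2 * (W (N + 1)).natDegree
  · by_cases hdc : c₁.natDegree < 4 * (W (N + 1)).natDegree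
    · have key := main_bound p hodd j (W (N + 2)) (W (N + 1)) A c₁ d y d₁ y₁
        (hW (N + 1) (by omega)) (hcn0 ▸ hd) hd₁ hc₁ hB hj.1 hj.2 hj1 hA0 hdA hdc
      have k1 : p ^ j * (2 * d.natDegree + 14 * c₁.roots.toFinset.card + 6 * d₁.natDegree)
          ≤ p ^ e * (2 * d.natDegree + 14 * rc₁.natDegree + 6 * d₁.natDegree) :=
        Nat.mul_le_mul hpe (by omega)
      have k2 : p ^ e * (2 * d.natDegree + 14 * rc₁.natDegree + 6 * d₁.natDegree)
          ≤ 8 * p ^ e * d.natDegree + 8 * p ^ e * (d₁.natDegree + 4 + 4 * rc₁.natDegree +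
          4 * rc₂.natDegree) := by
        have : 8 * p ^ e * d.natDegree + 8 * p ^ e * (d₁.natDegree + 4 + 4 * rc₁.natDegree +
          4 * rc₂.natDegree) = p ^ e * (8 * d.natDegree + 8 * (d₁.natDegree + 4 + 4 * rc₁.natDegree +
          4 * rc₂.natDegree)) := by ring
        rw [this]
        exact Nat.mul_le_mul_left _ (by omega)
      omega
    · omega
  · omega
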